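/- arXiv:2110.15686 — 2 statements merged into one kernel-verified Lean document; each statement's English description precedes it below -/
import Mathlib

section
/- Let m : Fin 6 → ℕ and let i1, i2, i3, i4 be four pairwise distinct indices in Fin 6. Set d = m i1 + m i2, and assume d = m i3 + m i4, and d ≥ m ia + m ib for each of the four cross pairs (a,b) ∈ {(i1,i3), (i1,i4), (i2,i3), (i2,i4)}. If, as integers, (d − 1)·(d − 2) ≥ Σ_{i ∈ Fin 6} m i · (m i − 1), then d ≤ 2. -/
/-- Combined arithmetic skeleton of the Proposition: for multiplicities `m : Fin 6 → ℕ`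
at six points, with `d = m i1 + m i2 = m i3 + m i4` for four distinct indices,
`d ≥ m ia + m ib` for the four cross pairs, and the genus inequality
`(d - 1)(d - 2) ≥ ∑ i, m i (m i - 1)`, the degree satisfies `d ≤ 2`. -/
theorem degree_le_two_of_six_multiplicities (m : Fin 6 → ℕ) (i1 i2 i3 i4 : Fin 6)
    (h12 : i1 ≠ i2) (h13 : i1 ≠ i3) (h14 : i1 ≠ i4)
    (h23 : i2 ≠ i3) (h24 : i2 ≠ i4) (h34 : i3 ≠ i4)
    (d : ℕ) (hd : d = m i1 + m i2) (hd' : d = m i3 + m i4)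
    (hc13 : d ≥ m i1 + m i3) (hc14 : d ≥ m i1 + m i4)
    (hc23 : d ≥ m i2 + m i3) (hc24 : d ≥ m i2 + m i4)
    (hgenus : ((d : ℤ) - 1) * ((d : ℤ) - 2) ≥
      ∑ i : Fin 6, (m i : ℤ) * ((m i : ℤ) - 1)) :
    d ≤ 2 := by
  have hsub : ∑ i ∈ {i1, i2, i3, i4}, (m i : ℤ) * ((m i : ℤ) - 1) ≤
      ∑ i : Fin 6, (m i : ℤ) * ((m i : ℤ) - 1) := by
    refine Finset.sum_le_sum_of_subset_of_nonneg (Finset.subset_univ _) fun i _ _ => ?_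
    rcases Nat.eq_zero_or_pos (m i) with h | h
    · simp [h]
    · exact mul_nonneg (by omega) (by omega)
  rw [Finset.sum_insert (by simp [h12, h13, h14]), Finset.sum_insert (by simp [h23, h24]),
    Finset.sum_pair h34] at hsub
  have h2 : m i2 = m i1 := by omega
  have h3 : m i3 = m i1 := by omega
  have h4 : m i4 = m i1 := by omega
  have hd2 : (d : ℤ) = 2 * m i1 := by omega
  rw [h2, h3, h4] at hsub
  rw [hd2] at hgenus
  have h1 : (m i1 : ℤ) ≤ 1 := by linarith
  omega
end

section
/- Let k be a field and let p1, p2, p3, p4, p5, p6 ∈ k³ be vectors such that any three of them are linearly independent (the corresponding six points of P²(k) are in general position). Suppose r ∈ k³ is a nonzero vector lying in span{p2, p3}, in span{p5, p6}, and in span{p1, p4}. Then every nonzero vector v ∈ span{p1, p4} that also lies in one of the six subspaces span{p1, p2}, span{p3, p4}, span{p5, p6}, span{p2, p3}, span{p4, p5}, span{p1, p6} is a scalar multiple of p1, of p4, or of r. -/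
theorem LinearIndependent.eq_zero_of_triple {k V : Type*} [Field k] [AddCommGroup V] [Module k V]
    {a b c : V} (h : LinearIndependent k ![a, b, c]) {s t u : k}
    (hs : s • a + t • b + u • c = 0) : s = 0 ∧ t = 0 ∧ u = 0 := by
  have H := Fintype.linearIndependent_iff.1 h ![s, t, u] (by simpa [Fin.sum_univ_three] using hs)
  exact ⟨H 0, H 1, H 2⟩

/-- Two distinct lines through a point meet only in that point. -/
theorem exists_eq_smul_of_mem_span_pair_of_mem_span_pair {k V : Type*} [Field k]
    [AddCommGroup V] [Module k V] {a b c v : V} (h : LinearIndependent k ![a, b, c])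
    (hb : v ∈ Submodule.span k ({a, b} : Set V)) (hc : v ∈ Submodule.span k ({a, c} : Set V)) :
    ∃ t : k, v = t • a := by
  obtain ⟨x, y, rfl⟩ := Submodule.mem_span_pair.1 hb
  obtain ⟨z, w, hzw⟩ := Submodule.mem_span_pair.1 hc
  have hrel : (x - z) • a + y • b + (-w) • c = 0 := by
    linear_combination (norm := module) -hzw
  obtain ⟨-, rfl, -⟩ := h.eq_zero_of_triple hrel
  exact ⟨x, by simp⟩

/-- Two distinct lines have at most one common point. -/
theorem exists_eq_smul_of_mem_span_pair_inter {k V : Type*} [Field k]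
    [AddCommGroup V] [Module k V] {a b c d r v : V} (h : LinearIndependent k ![a, b, c])
    (hr : r ≠ 0) (hrab : r ∈ Submodule.span k ({a, b} : Set V))
    (hrcd : r ∈ Submodule.span k ({c, d} : Set V))
    (hvab : v ∈ Submodule.span k ({a, b} : Set V))
    (hvcd : v ∈ Submodule.span k ({c, d} : Set V)) :
    ∃ t : k, v = t • r := by
  obtain ⟨x, y, hxy⟩ := Submodule.mem_span_pair.1 hrab
  obtain ⟨z, w, hzw⟩ := Submodule.mem_span_pair.1 hrcd
  obtain ⟨x', y', hxy'⟩ := Submodule.mem_span_pair.1 hvab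
  obtain ⟨z', w', hzw'⟩ := Submodule.mem_span_pair.1 hvcd
  have hw : w ≠ 0 := by
    rintro rfl
    have hrel : x • a + y • b + (-z) • c = 0 := by
      linear_combination (norm := module) hxy - hzw
    obtain ⟨rfl, rfl, -⟩ := h.eq_zero_of_triple hrel
    exact hr (by simpa using hxy.symm)
  have hrel : (w' * x - w * x') • a + (w' * y - w * y') • b + (w * z' - w' * z) • c = 0 := by
    linear_combination (norm := module) w' • hxy - w • hxy' - w' • hzw + w • hzw'
  obtain ⟨hx, hy, -⟩ := h.eq_zero_of_triple hrel
  have hwv : w • v = w' • r := by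
    rw [← hxy, ← hxy', smul_add, smul_add, smul_smul, smul_smul, smul_smul, smul_smul,
      sub_eq_zero.1 hx, sub_eq_zero.1 hy]
  exact ⟨w⁻¹ * w', by rw [mul_smul, ← hwv, inv_smul_smul₀ hw]⟩


/-- Geometric content of the "affine lines" example: six points of `ℙ²(k)` in general
position (any three representing vectors linearly independent), with
`R = ℓ₂₃ ∩ ℓ₅₆` lying on `ℓ₁₄`; then `ℓ₁₄` meets the union of the six lines
`ℓ₁₂, ℓ₃₄, ℓ₅₆, ℓ₂₃, ℓ₄₅, ℓ₁₆` only at `P₁`, `P₄` and `R`.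
Here `p 0, …, p 5` represent `P₁, …, P₆`. -/
theorem line_meets_divisor_in_three_points (k : Type*) [Field k]
    (p : Fin 6 → (Fin 3 → k))
    (hgen : ∀ i j l : Fin 6, i ≠ j → i ≠ l → j ≠ l →
      LinearIndependent k ![p i, p j, p l])
    (r : Fin 3 → k) (hr : r ≠ 0)
    (hr23 : r ∈ Submodule.span k ({p 1, p 2} : Set (Fin 3 → k)))
    (hr56 : r ∈ Submodule.span k ({p 4, p 5} : Set (Fin 3 → k)))
    (hr14 : r ∈ Submodule.span k ({p 0, p 3} : Set (Fin 3 → k))) :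
    ∀ v : Fin 3 → k, v ≠ 0 → v ∈ Submodule.span k ({p 0, p 3} : Set (Fin 3 → k)) →
      (v ∈ Submodule.span k ({p 0, p 1} : Set (Fin 3 → k)) ∨
       v ∈ Submodule.span k ({p 2, p 3} : Set (Fin 3 → k)) ∨
       v ∈ Submodule.span k ({p 4, p 5} : Set (Fin 3 → k)) ∨
       v ∈ Submodule.span k ({p 1, p 2} : Set (Fin 3 → k)) ∨
       v ∈ Submodule.span k ({p 3, p 4} : Set (Fin 3 → k)) ∨
       v ∈ Submodule.span k ({p 0, p 5} : Set (Fin 3 → k))) →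
      (∃ c : k, v = c • p 0) ∨ (∃ c : k, v = c • p 3) ∨ (∃ c : k, v = c • r) := by
  intro v _ hv h
  have hv' : v ∈ Submodule.span k ({p 3, p 0} : Set (Fin 3 → k)) := Set.pair_comm (p 0) _ ▸ hv
  rcases h with h | h | h | h | h | h
  · exact .inl (exists_eq_smul_of_mem_span_pair_of_mem_span_pair
      (hgen 0 3 1 (by decide) (by decide) (by decide)) hv h)
  · rw [Set.pair_comm] at h
    exact .inr (.inl (exists_eq_smul_of_mem_span_pair_of_mem_span_pair
      (hgen 3 0 2 (by decide) (by decide) (by decide)) hv' h))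
  · exact .inr (.inr (exists_eq_smul_of_mem_span_pair_inter
      (hgen 0 3 4 (by decide) (by decide) (by decide)) hr hr14 hr56 hv h))
  · exact .inr (.inr (exists_eq_smul_of_mem_span_pair_inter
      (hgen 0 3 1 (by decide) (by decide) (by decide)) hr hr14 hr23 hv h))
  · exact .inr (.inl (exists_eq_smul_of_mem_span_pair_of_mem_span_pair
      (hgen 3 0 4 (by decide) (by decide) (by decide)) hv' h))
  · exact .inl (exists_eq_smul_of_mem_span_pair_of_mem_span_pair
      (hgen 0 3 5 (by decide) (by decide) (by decide)) hv h)
end
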